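/- Fix any α₁ ∈ (0,1). Under the full assumptions and Algorithm 1, for every N ≥ 1: 2L̄ ∑_{k=1}^N c(k) ∑_{i=1}^m ‖x_i(k+1) − v̄(k+1)‖ < α₁ ∑_{k=1}^N ∑_{i=1}^m ‖e_i(k+1)‖² + α₂ ∑_{k=1}^N c(k)² + α₃, where α₂ = (2/α₁) m μ² L̄² (m² λ² /(1−q)² + 4) and α₃ = 2 m³ μ² λ² L̄² c(0)² /(α₁ (1−q)²) + 2 m² μ λ L̄ D c(1) q/(1−q) + 2 α₁ m D². -/

import Mathlib

open Filter Finset Metric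
open scoped Topology BigOperators

/-- The product `A (s + t - 1) * ⋯ * A s` of `t` consecutive matrices. -/
def transition {m : ℕ} (A : ℕ → Matrix (Fin m) (Fin m) ℝ) (s : ℕ) :
    ℕ → Matrix (Fin m) (Fin m) ℝ
  | 0 => 1
  | t + 1 => A (s + t) * transition A s t

section Transition

variable {m : ℕ} {A : ℕ → Matrix (Fin m) (Fin m) ℝ}

theorem transition_add (s t u : ℕ) :
    transition A s (t + u) = transition A (s + t) u * transition A s t := by
  induction u with
  | zero => simp [transition]
  | succ u ih => rw [← add_assoc, transition, ih, transition, Matrix.mul_assoc, add_assoc]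

theorem transition_one (s : ℕ) : transition A s 1 = A s := by
  simp [transition]

theorem transition_mem_doublyStochastic (hA : ∀ k, A k ∈ doublyStochastic ℝ (Fin m)) (s t : ℕ) :
    transition A s t ∈ doublyStochastic ℝ (Fin m) := by
  induction t with
  | zero => exact one_mem _
  | succ t ih => exact mul_mem (hA _) ih

theorem pow_le_transition (hA : ∀ k, A k ∈ doublyStochastic ℝ (Fin m)) {η : ℝ} (hη : 0 ≤ η)
    (hpos : ∀ k i j, 0 < A k i j → η ≤ A k i j) (s t : ℕ) (i j : Fin m)
    (h : 0 < transition A s t i j) : η ^ t ≤ transition A s t i j := by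
  induction t generalizing i with
  | zero =>
    by_cases hij : i = j
    · subst hij
      simp [transition]
    · simp [transition, hij] at h
  | succ t ih =>
    have hP := fun l => nonneg_of_mem_doublyStochastic (transition_mem_doublyStochastic hA s t)
      (i := l) (j := j)
    have hA0 := fun l => nonneg_of_mem_doublyStochastic (hA (s + t)) (i := i) (j := l)
    rw [transition, Matrix.mul_apply] at h ⊢
    obtain ⟨l, -, hl⟩ := exists_lt_of_sum_lt (s := univ) (f := fun _ => (0 : ℝ))
      (g := fun l => A (s + t) i l * transition A s t l j) (by simpa using h)
    have h1 : 0 < A (s + t) i l := (hA0 l).lt_of_ne' (left_ne_zero_of_mul hl.ne')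
    have h2 : 0 < transition A s t l j := (hP l).lt_of_ne' (right_ne_zero_of_mul hl.ne')
    calc η ^ (t + 1) = η * η ^ t := by ring
      _ ≤ A (s + t) i l * transition A s t l j :=
        mul_le_mul (hpos _ _ _ h1) (ih l h2) (pow_nonneg hη _) (hA0 l)
      _ ≤ _ := single_le_sum (f := fun l => A (s + t) i l * transition A s t l j)
        (fun l _ => mul_nonneg (hA0 l) (hP l)) (mem_univ l)

theorem transition_pos_step (hA : ∀ k, A k ∈ doublyStochastic ℝ (Fin m)) {s t : ℕ} {i l j : Fin m}
    (hil : 0 < A (s + t) i l) (h : 0 < transition A s t l j) :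
    0 < transition A s (t + 1) i j := by
  rw [transition, Matrix.mul_apply]
  refine sum_pos' (fun l' _ => mul_nonneg (nonneg_of_mem_doublyStochastic (hA _))
    (nonneg_of_mem_doublyStochastic (transition_mem_doublyStochastic hA _ _)))
    ⟨l, mem_univ l, mul_pos hil h⟩

theorem transition_pos_mono (hA : ∀ k, A k ∈ doublyStochastic ℝ (Fin m))
    (hdiag : ∀ k i, 0 < A k i i) {s t u : ℕ} (htu : t ≤ u) {i j : Fin m}
    (h : 0 < transition A s t i j) : 0 < transition A s u i j := by
  induction u, htu using Nat.le_induction with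
  | base => exact h
  | succ u _ ih => exact transition_pos_step hA (hdiag _ _) ih

/-- A path that starts in a proper set and leaves it crosses its boundary. -/
theorem exists_rel_of_mem_of_notMem {α : Type*} {r : α → α → Prop} {u v : α}
    (h : Relation.ReflTransGen r u v) {S : Set α} (hu : u ∈ S) (hv : v ∉ S) :
    ∃ p ∈ S, ∃ p' ∉ S, r p p' := by
  induction h with
  | refl => exact absurd hu hv
  | @tail p p' _ hr ih =>
    by_cases hp : p ∈ S
    · exact ⟨p, hp, p', hv, hr⟩
    · exact ih hp

theorem transition_pos (hA : ∀ k, A k ∈ doublyStochastic ℝ (Fin m))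
    (hdiag : ∀ k i, 0 < A k i i)
    (hconn : ∀ u v : Fin m,
      Relation.ReflTransGen (fun p₁ p₂ => {k : ℕ | 0 < A k p₂ p₁}.Infinite) u v)
    {T : ℕ} (hT : ∀ j i : Fin m, {k : ℕ | 0 < A k i j}.Infinite →
      ∀ k : ℕ, ∃ l, k ≤ l ∧ l < k + T ∧ 0 < A l i j) (s : ℕ) (i j : Fin m) :
    0 < transition A s ((m - 1) * T) i j := by
  classical
  let R : ℕ → Finset (Fin m) := fun t => univ.filter fun i => 0 < transition A s t i j
  have hR : ∀ t i, i ∈ R t ↔ 0 < transition A s t i j := by simp [R]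
  have hmono : ∀ {t u}, t ≤ u → R t ⊆ R u := fun htu i hi =>
    (hR _ _).2 (transition_pos_mono hA hdiag htu ((hR _ _).1 hi))
  have hj : ∀ t, j ∈ R t := fun t =>
    hmono t.zero_le ((hR _ _).2 (by simp [transition]))
  have hcard : ∀ r, min m (r + 1) ≤ (R (r * T)).card := by
    intro r
    induction r with
    | zero => exact (min_le_right _ _).trans (card_pos.2 ⟨j, hj _⟩)
    | succ r ih =>
      have hsub : R (r * T) ⊆ R ((r + 1) * T) := hmono (by gcongr; omega)
      by_cases hall : R (r * T) = univ
      · have := card_le_card hsub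
        rw [hall, card_univ, Fintype.card_fin] at this
        exact (min_le_left _ _).trans this
      · obtain ⟨w, hw⟩ : ∃ w, w ∉ R (r * T) := by
          by_contra! hne
          exact hall (eq_univ_iff_forall.2 hne)
        obtain ⟨p, hp, p', hp', hinf⟩ := exists_rel_of_mem_of_notMem (hconn j w)
          (S := (R (r * T) : Set (Fin m))) (hj _) hw
        obtain ⟨l, hl1, hl2, hl⟩ := hT p p' hinf (s + r * T)
        obtain ⟨t, rfl⟩ : ∃ t, l = s + t := ⟨l - s, by omega⟩
        have hnew : p' ∈ R (t + 1) := (hR _ _).2 (transition_pos_step hA hl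
          ((hR _ _).1 (hmono (by omega) hp)))
        have hlt : R (r * T) ⊂ R ((r + 1) * T) :=
          ssubset_iff_of_subset hsub |>.2
            ⟨p', hmono (by rw [add_mul]; omega) hnew, hp'⟩
        have := card_lt_card hlt
        omega
  have hm : 0 < m := i.pos
  have h := hcard (m - 1)
  rw [Nat.sub_add_cancel hm, min_self] at h
  have huniv : R ((m - 1) * T) = univ :=
    eq_univ_of_card _ (le_antisymm (card_le_univ _) (by simpa using h))
  exact (hR _ _).1 (huniv ▸ mem_univ i)

/-- A stochastic matrix with entries at least `δ` shrinks the range of a vector by `1 - δ`. -/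
theorem mulVec_range_contract {W : Matrix (Fin m) (Fin m) ℝ} {δ : ℝ} (hδ : 0 ≤ δ)
    (hW : ∀ i j, δ ≤ W i j) (hrow : ∀ i, ∑ j, W i j = 1) {y : Fin m → ℝ} {b w : ℝ} (hw : 0 ≤ w)
    (hb : ∀ i, b ≤ y i) (hbw : ∀ i, y i ≤ b + w) :
    ∃ b', ∀ i, b' ≤ ∑ j, W i j * y j ∧ ∑ j, W i j * y j ≤ b' + (1 - δ) * w := by
  refine ⟨b + δ * ∑ j, (y j - b), fun i => ⟨?_, ?_⟩⟩
  · have h : δ * ∑ j, (y j - b) ≤ ∑ j, W i j * (y j - b) := by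
      rw [mul_sum]
      exact sum_le_sum fun j _ => mul_le_mul_of_nonneg_right (hW i j) (by linarith [hb j])
    simp only [mul_sub, sum_sub_distrib, ← sum_mul, hrow] at h ⊢
    linarith
  · have h : δ * ∑ j, (b + w - y j) ≤ ∑ j, W i j * (b + w - y j) := by
      rw [mul_sum]
      exact sum_le_sum fun j _ => mul_le_mul_of_nonneg_right (hW i j) (by linarith [hbw j])
    have hm : (1 : ℝ) ≤ m := by exact_mod_cast i.pos
    have hmw : δ * w ≤ δ * (m * w) := by
      gcongr
      nlinarith
    simp only [mul_sub, sum_sub_distrib, ← sum_mul, hrow, sum_const, card_univ,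
      Fintype.card_fin, nsmul_eq_mul] at h ⊢
    linarith

theorem transition_range (hA : ∀ k, A k ∈ doublyStochastic ℝ (Fin m)) {B : ℕ} {δ : ℝ}
    (hδ : 0 ≤ δ) (hδ1 : δ ≤ 1) (hB : ∀ s i j, δ ≤ transition A s B i j) (s r u : ℕ) (j : Fin m) :
    ∃ b, ∀ i, b ≤ transition A s (B * r + u) i j ∧
      transition A s (B * r + u) i j ≤ b + (1 - δ) ^ r := by
  have hP := transition_mem_doublyStochastic hA
  have hw : ∀ r : ℕ, 0 ≤ (1 - δ) ^ r := fun r => pow_nonneg (by linarith) r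
  have hblock : ∃ b, ∀ i, b ≤ transition A s (B * r) i j ∧
      transition A s (B * r) i j ≤ b + (1 - δ) ^ r := by
    induction r with
    | zero =>
      refine ⟨0, fun i => ⟨nonneg_of_mem_doublyStochastic (hP _ _), ?_⟩⟩
      simpa using le_one_of_mem_doublyStochastic (hP s 0) (i := i) (j := j)
    | succ r ih =>
      obtain ⟨b, hb⟩ := ih
      obtain ⟨b', hb'⟩ := mulVec_range_contract hδ (hB (s + B * r))
        (sum_row_of_mem_doublyStochastic (hP _ _)) (hw r) (fun i => (hb i).1) (fun i => (hb i).2)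
      refine ⟨b', fun i => ?_⟩
      rw [mul_add_one, transition_add, Matrix.mul_apply, pow_succ']
      exact hb' i
  obtain ⟨b, hb⟩ := hblock
  obtain ⟨b', hb'⟩ := mulVec_range_contract le_rfl
    (fun i j => nonneg_of_mem_doublyStochastic (hP (s + B * r) u))
    (sum_row_of_mem_doublyStochastic (hP _ _)) (hw r) (fun i => (hb i).1) (fun i => (hb i).2)
  refine ⟨b', fun i => ?_⟩
  rw [transition_add, Matrix.mul_apply]
  simpa using hb' i

theorem abs_transition_sub_le (hA : ∀ k, A k ∈ doublyStochastic ℝ (Fin m)) {B : ℕ} {δ : ℝ}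
    (hδ : 0 ≤ δ) (hδ1 : δ ≤ 1) (hB : ∀ s i j, δ ≤ transition A s B i j) (s t : ℕ) (i j : Fin m) :
    |transition A s t i j - (m : ℝ)⁻¹| ≤ (1 - δ) ^ (t / B) := by
  obtain ⟨b, hb⟩ := transition_range hA hδ hδ1 hB s (t / B) (t % B) j
  rw [Nat.div_add_mod] at hb
  have hcol := sum_col_of_mem_doublyStochastic (transition_mem_doublyStochastic hA s t) j
  have hm : (0 : ℝ) < m := by exact_mod_cast i.pos
  have h1 : m * b ≤ 1 := by
    simpa [hcol] using sum_le_sum fun i (_ : i ∈ univ) => (hb i).1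
  have h2 : 1 ≤ m * (b + (1 - δ) ^ (t / B)) := by
    simpa [hcol, mul_add] using sum_le_sum fun i (_ : i ∈ univ) => (hb i).2
  have h1' : b ≤ (m : ℝ)⁻¹ := by rwa [← one_div, le_div_iff₀' hm]
  have h2' : (m : ℝ)⁻¹ ≤ b + (1 - δ) ^ (t / B) := by rwa [← one_div, div_le_iff₀' hm]
  rw [abs_le]
  constructor <;> linarith [(hb i).1, (hb i).2]

theorem average_succ {E : Type*} [AddCommGroup E] [Module ℝ E]
    (hA : ∀ k, A k ∈ doublyStochastic ℝ (Fin m)) {x z : Fin m → ℕ → E} {v : ℕ → E}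
    (hz : ∀ i k, z i k = ∑ j, A k i j • x j k) (hv : ∀ k, v k = (m : ℝ)⁻¹ • ∑ i, x i k) (k : ℕ) :
    v (k + 1) = v k + (m : ℝ)⁻¹ • ∑ j, (x j (k + 1) - z j k) := by
  have hsum : ∑ i, z i k = ∑ j, x j k := by
    simp only [hz]
    rw [sum_comm]
    simp only [← sum_smul, sum_col_of_mem_doublyStochastic (hA k), one_smul]
  rw [hv, hv, ← smul_add, sum_sub_distrib, hsum]
  congr 1
  abel

/-- Deviation from the average in a perturbed consensus iteration. -/
theorem norm_consensus_sub_average_le {E : Type*} [NormedAddCommGroup E] [NormedSpace ℝ E]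
    (hA : ∀ k, A k ∈ doublyStochastic ℝ (Fin m)) {lam q : ℝ}
    (hgeo : ∀ s t i j, |transition A s (t + 1) i j - (m : ℝ)⁻¹| ≤ lam * q ^ t)
    {x z : Fin m → ℕ → E} {v : ℕ → E} (hz : ∀ i k, z i k = ∑ j, A k i j • x j k)
    (hv : ∀ k, v k = (m : ℝ)⁻¹ • ∑ i, x i k) (k t : ℕ) (i : Fin m) :
    ‖∑ j, transition A k (t + 1) i j • x j k - v k‖ ≤
      lam * (q ^ (k + t) * ∑ j, ‖x j 0‖ +
        ∑ r ∈ range k, q ^ (k - 1 - r + t) * ∑ j, ‖x j (r + 1) - z j r‖) := by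
  have key : ∀ s t i (y : Fin m → E),
      ‖∑ j, (transition A s (t + 1) i j - (m : ℝ)⁻¹) • y j‖ ≤ lam * q ^ t * ∑ j, ‖y j‖ := by
    intro s t i y
    rw [mul_sum]
    refine norm_sum_le_of_le _ fun j _ => ?_
    rw [norm_smul, Real.norm_eq_abs]
    exact mul_le_mul_of_nonneg_right (hgeo _ _ _ _) (norm_nonneg _)
  induction k generalizing t with
  | zero =>
    have h := key 0 t i (fun j => x j 0)
    simp only [sub_smul, sum_sub_distrib, ← smul_sum] at h
    simpa [hv, mul_assoc] using h
  | succ k ih =>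
    have hx : ∑ j, transition A (k + 1) (t + 1) i j • x j (k + 1) =
        ∑ j, transition A k (t + 1 + 1) i j • x j k +
          ∑ j, transition A (k + 1) (t + 1) i j • (x j (k + 1) - z j k) := by
      have hzs : ∑ j, transition A k (t + 1 + 1) i j • x j k =
          ∑ j, transition A (k + 1) (t + 1) i j • z j k := by
        rw [add_comm (t + 1) 1, transition_add, transition_one]
        simp only [Matrix.mul_apply, hz, sum_smul, smul_sum, mul_smul]
        exact sum_comm
      rw [hzs, ← sum_add_distrib]
      simp [smul_sub]
    have h := key (k + 1) t i (fun j => x j (k + 1) - z j k)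
    have hsplit : ∑ j, transition A (k + 1) (t + 1) i j • x j (k + 1) - v (k + 1) =
        (∑ j, transition A k (t + 1 + 1) i j • x j k - v k) +
          ∑ j, (transition A (k + 1) (t + 1) i j - (m : ℝ)⁻¹) • (x j (k + 1) - z j k) := by
      rw [hx, average_succ hA hz hv]
      simp only [sub_smul _ (m : ℝ)⁻¹, sum_sub_distrib (f := fun j => _ • _), ← smul_sum]
      abel
    rw [hsplit]
    refine (norm_add_le_of_le (ih (t + 1)) h).trans (le_of_eq ?_)
    rw [sum_range_succ]
    have hexp : ∀ r ∈ range k, q ^ (k + 1 - 1 - r + t) * ∑ j, ‖x j (r + 1) - z j r‖ =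
        q ^ (k - 1 - r + (t + 1)) * ∑ j, ‖x j (r + 1) - z j r‖ := by
      intro r hr
      have := mem_range.1 hr
      congr 2
      omega
    rw [sum_congr rfl hexp]
    simp only [add_tsub_cancel_right, tsub_self, zero_add]
    ring

theorem sum_norm_sub_average_le {E : Type*} [NormedAddCommGroup E] [NormedSpace ℝ E]
    (hA : ∀ k, A k ∈ doublyStochastic ℝ (Fin m)) {lam q : ℝ}
    (hgeo : ∀ s t i j, |transition A s (t + 1) i j - (m : ℝ)⁻¹| ≤ lam * q ^ t)
    {x z : Fin m → ℕ → E} {v : ℕ → E} (hz : ∀ i k, z i k = ∑ j, A k i j • x j k)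
    (hv : ∀ k, v k = (m : ℝ)⁻¹ • ∑ i, x i k) (hm : 0 < m) (k : ℕ) :
    ∑ i, ‖x i (k + 1) - v (k + 1)‖ ≤
      m * lam * (q ^ k * ∑ j, ‖x j 0‖ +
        ∑ r ∈ range k, q ^ (k - 1 - r) * ∑ j, ‖x j (r + 1) - z j r‖) +
      2 * ∑ j, ‖x j (k + 1) - z j k‖ := by
  have hm' : (m : ℝ) ≠ 0 := by positivity
  have hzv : ∀ i, ‖z i k - v k‖ ≤ lam * (q ^ k * ∑ j, ‖x j 0‖ +
      ∑ r ∈ range k, q ^ (k - 1 - r) * ∑ j, ‖x j (r + 1) - z j r‖) := by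
    intro i
    simpa [transition_one, ← hz] using norm_consensus_sub_average_le hA hgeo hz hv k 0 i
  have hmean : ‖(m : ℝ)⁻¹ • ∑ j, (x j (k + 1) - z j k)‖ ≤
      (m : ℝ)⁻¹ * ∑ j, ‖x j (k + 1) - z j k‖ := by
    rw [norm_smul, Real.norm_of_nonneg (by positivity)]
    gcongr
    exact norm_sum_le _ _
  have hi : ∀ i, ‖x i (k + 1) - v (k + 1)‖ ≤ lam * (q ^ k * ∑ j, ‖x j 0‖ +
      ∑ r ∈ range k, q ^ (k - 1 - r) * ∑ j, ‖x j (r + 1) - z j r‖) +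
      ‖x i (k + 1) - z i k‖ + (m : ℝ)⁻¹ * ∑ j, ‖x j (k + 1) - z j k‖ := by
    intro i
    have hsplit : x i (k + 1) - v (k + 1) = (z i k - v k) + (x i (k + 1) - z i k) -
        (m : ℝ)⁻¹ • ∑ j, (x j (k + 1) - z j k) := by
      rw [average_succ hA hz hv]
      abel
    rw [hsplit]
    exact norm_sub_le_of_le (norm_add_le_of_le (hzv i) le_rfl) hmean
  refine (sum_le_sum fun i _ => hi i).trans (le_of_eq ?_)
  simp only [sum_add_distrib (ι := Fin m), sum_const, card_univ, Fintype.card_fin, nsmul_eq_mul]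
  field_simp
  ring

end Transition

theorem pow_div_le_mul_pow {q δ lam : ℝ} {B : ℕ} (hB : 0 < B) (hq0 : 0 < q) (hq1 : q < 1)
    (hqB : q ^ B = 1 - δ) (hδ : 0 < δ) (hlam : lam = 2 * (1 + δ⁻¹) / (1 - δ)) (t : ℕ) :
    (1 - δ) ^ ((t + 1) / B) ≤ lam * q ^ t := by
  have hδ1 : 0 < 1 - δ := hqB ▸ pow_pos hq0 B
  have hexp : t ≤ B * ((t + 1) / B) + B := by
    have := Nat.lt_mul_div_succ (t + 1) hB
    rw [mul_add, mul_one] at this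
    omega
  have h1 : (1 - δ) ^ ((t + 1) / B) * (1 - δ) ≤ q ^ t := by
    conv_lhs => rw [← hqB, ← pow_mul, ← pow_add]
    exact pow_le_pow_of_le_one hq0.le hq1.le hexp
  have h2 : 1 / (1 - δ) ≤ lam := by
    rw [hlam]
    have : 0 < δ⁻¹ := inv_pos.2 hδ
    gcongr
    linarith
  calc (1 - δ) ^ ((t + 1) / B) ≤ 1 / (1 - δ) * q ^ t := by
        rw [one_div_mul_eq_div, le_div_iff₀ hδ1]
        exact h1
    _ ≤ lam * q ^ t := mul_le_mul_of_nonneg_right h2 (pow_nonneg hq0.le _)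

theorem sum_mul_geometric_convolution_le {c e : ℕ → ℝ} {q : ℝ} (hc : ∀ k, 0 ≤ c k)
    (hanti : Antitone c) (he : ∀ k, 0 ≤ e k) (hq0 : 0 ≤ q) (hq1 : q < 1) (N : ℕ) :
    ∑ k ∈ Icc 1 N, c k * ∑ r ∈ range k, q ^ (k - 1 - r) * e r ≤
      (1 - q)⁻¹ * ∑ r ∈ range N, c r * e r := by
  set G : ℕ → ℝ := fun k => ∑ r ∈ range k, q ^ (k - 1 - r) * e r with hG
  have hG0 : ∀ k, 0 ≤ G k := fun k => sum_nonneg fun r _ => mul_nonneg (pow_nonneg hq0 _) (he r)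
  have hGs : ∀ k, G (k + 1) = q * G k + e k := by
    intro k
    simp only [hG, sum_range_succ, mul_sum, add_tsub_cancel_right, tsub_self, pow_zero, one_mul]
    congr 1
    refine sum_congr rfl fun r hr => ?_
    have := mem_range.1 hr
    rw [← mul_assoc, ← pow_succ']
    congr 2
    omega
  have key : (1 - q) * ∑ k ∈ Icc 1 N, c k * G k + q * (c N * G N) ≤
      ∑ r ∈ range N, c r * e r := by
    induction N with
    | zero => simp [hG]
    | succ N ih =>
      rw [sum_Icc_succ_top (by omega), sum_range_succ]
      have h1 : c (N + 1) ≤ c N := hanti N.le_succ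
      have h2 : c (N + 1) * G (N + 1) ≤ q * (c N * G N) + c N * e N := by
        rw [hGs]
        have := mul_le_mul_of_nonneg_right h1 (add_nonneg (mul_nonneg hq0 (hG0 N)) (he N))
        linarith
      linarith
  rw [inv_mul_eq_div, le_div_iff₀ (by linarith), mul_comm]
  have := mul_nonneg hq0 (mul_nonneg (hc N) (hG0 N))
  linarith

theorem sum_mul_pow_le {c : ℕ → ℝ} {q : ℝ} (hc : ∀ k, 0 ≤ c k) (hanti : Antitone c)
    (hq0 : 0 ≤ q) (hq1 : q < 1) (N : ℕ) :
    ∑ k ∈ Icc 1 N, c k * q ^ k ≤ c 1 * (q / (1 - q)) := by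
  have key : (1 - q) * ∑ k ∈ Icc 1 N, q ^ k = q - q ^ (N + 1) := by
    induction N with
    | zero => simp
    | succ N ih => rw [sum_Icc_succ_top (by omega), mul_add, ih]; ring
  have h1 : ∑ k ∈ Icc 1 N, q ^ k ≤ q / (1 - q) := by
    rw [le_div_iff₀ (by linarith), mul_comm, key]
    linarith [pow_nonneg hq0 (N + 1)]
  calc ∑ k ∈ Icc 1 N, c k * q ^ k ≤ ∑ k ∈ Icc 1 N, c 1 * q ^ k :=
        sum_le_sum fun k hk => mul_le_mul_of_nonneg_right (hanti (mem_Icc.1 hk).1)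
          (pow_nonneg hq0 k)
    _ = c 1 * ∑ k ∈ Icc 1 N, q ^ k := (mul_sum _ _ _).symm
    _ ≤ _ := mul_le_mul_of_nonneg_left h1 (hc 1)

/-- Young's inequality, summed over a finite family. -/
theorem mul_sum_le_sum_sq {m : ℕ} {α : ℝ} (hα : 0 < α) (K : ℝ) (y : Fin m → ℝ) :
    K * ∑ i, y i ≤ α / 2 * ∑ i, y i ^ 2 + m * (K ^ 2 / (2 * α)) := by
  have h : ∀ i, K * y i ≤ α / 2 * y i ^ 2 + K ^ 2 / (2 * α) := by
    intro i
    have : α / 2 * y i ^ 2 + K ^ 2 / (2 * α) - K * y i = (α * y i - K) ^ 2 / (2 * α) := by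
      field_simp
      ring
    have : 0 ≤ (α * y i - K) ^ 2 / (2 * α) := by positivity
    linarith
  have := sum_le_sum fun i (_ : i ∈ univ) => h i
  simpa [← mul_sum, sum_add_distrib] using this

theorem sum_norm_sub_shrink_le {E : Type*} [NormedAddCommGroup E] [NormedSpace ℝ E] {m : ℕ}
    {X : Fin m → Set E} {y : Fin m → E} (hy : ∀ i, y i ∈ X i) {v xbar : E} {D ρ : ℝ}
    (hv : ‖v‖ ≤ D) (hxbar : ‖xbar‖ ≤ D) (hρ : 0 < ρ) {ε : ℝ} (hε : ε = ∑ i, infDist v (X i)) :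
    ∑ i, ‖y i - ((ε / (ε + ρ)) • xbar + (ρ / (ε + ρ)) • v)‖ ≤
      ((2 / ρ) * m * D + 1) * ∑ i, ‖y i - v‖ := by
  have hε0 : 0 ≤ ε := hε ▸ sum_nonneg fun i _ => infDist_nonneg
  have hD : 0 ≤ D := (norm_nonneg _).trans hv
  have hεle : ε ≤ ∑ i, ‖y i - v‖ := by
    rw [hε]
    refine sum_le_sum fun i _ => (infDist_le_dist_of_mem (hy i)).trans_eq ?_
    rw [dist_comm, dist_eq_norm]
  have hsub : v - ((ε / (ε + ρ)) • xbar + (ρ / (ε + ρ)) • v) = (ε / (ε + ρ)) • (v - xbar) := by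
    have : ρ / (ε + ρ) = 1 - ε / (ε + ρ) := by
      field_simp
      ring
    rw [this]
    module
  have hdist : ‖v - ((ε / (ε + ρ)) • xbar + (ρ / (ε + ρ)) • v)‖ ≤ ε / ρ * (2 * D) := by
    rw [hsub, norm_smul, Real.norm_of_nonneg (by positivity)]
    have h1 : ‖v - xbar‖ ≤ 2 * D := (norm_sub_le _ _).trans (by linarith)
    gcongr
    linarith
  calc ∑ i, ‖y i - ((ε / (ε + ρ)) • xbar + (ρ / (ε + ρ)) • v)‖
      ≤ ∑ i, (‖y i - v‖ + ε / ρ * (2 * D)) := sum_le_sum fun i _ =>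
        (norm_sub_le_norm_sub_add_norm_sub _ v _).trans (by linarith)
    _ = ∑ i, ‖y i - v‖ + (2 / ρ) * m * D * ε := by
        rw [sum_add_distrib]
        simp only [sum_const, card_univ, Fintype.card_fin, nsmul_eq_mul]
        ring
    _ ≤ ∑ i, ‖y i - v‖ + (2 / ρ) * m * D * ∑ i, ‖y i - v‖ := by gcongr
    _ = _ := by ring

theorem stmt6
    (n m : ℕ) (hm : 2 ≤ m)
    (X : Fin m → Set (EuclideanSpace ℝ (Fin n)))
    (hXne : ∀ i, (X i).Nonempty)
    (hXcpt : ∀ i, IsCompact (X i))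
    (hXconv : ∀ i, Convex ℝ (X i))
    (f : Fin m → EuclideanSpace ℝ (Fin n) → ℝ)
    (hfconv : ∀ i, ConvexOn ℝ Set.univ (f i))
    (Lbar : ℝ) (hLbar : 0 < Lbar)
    (hLip : ∀ i, ∀ p₁ ∈ X i, ∀ p₂ ∈ X i, |f i p₁ - f i p₂| ≤ Lbar * ‖p₁ - p₂‖)
    (D : ℝ) (hD : 0 < D)
    (hDbound : ∀ p ∈ convexHull ℝ (⋃ i, X i), ‖p‖ ≤ D)
    (xbar : EuclideanSpace ℝ (Fin n)) (ρ : ℝ) (hρ : 0 < ρ)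
    (hball : Metric.ball xbar ρ ⊆ ⋂ i, X i)
    (a : ℕ → Fin m → Fin m → ℝ)
    (ha_nonneg : ∀ k i j, 0 ≤ a k i j)
    (ha_row : ∀ k i, ∑ j, a k i j = 1)
    (ha_col : ∀ k j, ∑ i, a k i j = 1)
    (η : ℝ) (hη : η ∈ Set.Ioo (0:ℝ) 1)
    (ha_diag : ∀ k i, η ≤ a k i i)
    (ha_eta : ∀ k i j, 0 < a k i j → η ≤ a k i j)
    (hconn : ∀ u v : Fin m,
      Relation.ReflTransGen (fun p1 p2 => {k : ℕ | 0 < a k p2 p1}.Infinite) u v)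
    (T : ℕ) (hT : 1 ≤ T)
    (hTcomm : ∀ j i : Fin m, {k : ℕ | 0 < a k i j}.Infinite →
      ∀ k : ℕ, ∃ l, k ≤ l ∧ l < k + T ∧ 0 < a l i j)
    (c : ℕ → ℝ) (hc_pos : ∀ k, 0 < c k) (hc_anti : Antitone c)
    (hc_div : Tendsto (fun N => ∑ k ∈ Finset.range N, c k) atTop atTop)
    (hc_sq : Summable (fun k => (c k)^2))
    (x : Fin m → ℕ → EuclideanSpace ℝ (Fin n))
    (hx0 : ∀ i, x i 0 ∈ X i)
    (z : Fin m → ℕ → EuclideanSpace ℝ (Fin n))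
    (hz : ∀ i k, z i k = ∑ j, a k i j • x j k)
    (hupd_mem : ∀ i k, x i (k+1) ∈ X i)
    (hupd_min : ∀ i k, ∀ y ∈ X i,
      f i (x i (k+1)) + (1/(2 * c k)) * ‖z i k - x i (k+1)‖^2
        ≤ f i y + (1/(2 * c k)) * ‖z i k - y‖^2)
    (hupd_uniq : ∀ i k, ∀ y ∈ X i,
      f i y + (1/(2 * c k)) * ‖z i k - y‖^2
        = f i (x i (k+1)) + (1/(2 * c k)) * ‖z i k - x i (k+1)‖^2 → y = x i (k+1))
    (v : ℕ → EuclideanSpace ℝ (Fin n))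
    (hv : ∀ k, v k = (m : ℝ)⁻¹ • ∑ i, x i k)
    (eps : ℕ → ℝ)
    (heps : ∀ k, eps k = ∑ i, Metric.infDist (v k) (X i))
    (vbar : ℕ → EuclideanSpace ℝ (Fin n))
    (hvbar : ∀ k, vbar k = (eps k / (eps k + ρ)) • xbar + (ρ / (eps k + ρ)) • v k)
    (μ : ℝ) (hμ : μ = (2 / ρ) * (m : ℝ) * D + 1)
    (lam q : ℝ)
    (hlam : lam = 2 * (1 + (η ^ ((m - 1) * T))⁻¹) / (1 - η ^ ((m - 1) * T)))
    (hq : q = Real.rpow (1 - η ^ ((m - 1) * T)) ((((m - 1) * T : ℕ) : ℝ))⁻¹)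
    (α₁ : ℝ) (hα₁ : α₁ ∈ Set.Ioo (0:ℝ) 1)
    (α₂ α₃ : ℝ)
    (hα₂ : α₂ = (2 / α₁) * (m : ℝ) * μ^2 * Lbar^2
      * ((m : ℝ)^2 * lam^2 * (1 / (1 - q)^2) + 4))
    (hα₃ : α₃ = 2 * (m : ℝ)^3 * μ^2 * lam^2 * Lbar^2 * (c 0)^2 * (1 / (α₁ * (1 - q)^2))
      + 2 * (m : ℝ)^2 * μ * lam * Lbar * D * c 1 * (q / (1 - q)) + 2 * α₁ * (m : ℝ) * D^2)
    :
    ∀ N : ℕ, 1 ≤ N →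
      2 * Lbar * ∑ k ∈ Finset.Icc 1 N, c k * ∑ i, ‖x i (k + 1) - vbar (k + 1)‖
        < α₁ * ∑ k ∈ Finset.Icc 1 N, ∑ i, ‖x i (k + 1) - z i k‖^2
          + α₂ * ∑ k ∈ Finset.Icc 1 N, (c k)^2 + α₃ := by
  obtain ⟨hα0, -⟩ := hα₁
  obtain ⟨hη0, hη1⟩ := hη
  intro N hN
  have hm0 : 0 < m := by omega
  have hmR : (0 : ℝ) < m := by exact_mod_cast hm0
  have hA : ∀ k, (Matrix.of (a k)) ∈ doublyStochastic ℝ (Fin m) := fun k =>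
    mem_doublyStochastic_iff_sum.2 ⟨ha_nonneg k, ha_row k, ha_col k⟩
  have hB : 0 < (m - 1) * T := Nat.mul_pos (by omega) hT
  set δ := η ^ ((m - 1) * T) with hδ
  have hδ0 : 0 < δ := pow_pos hη0 _
  have hδ1 : δ < 1 := pow_lt_one₀ hη0.le hη1 hB.ne'
  have hqB : q ^ ((m - 1) * T) = 1 - δ := by
    rw [hq]
    exact Real.rpow_inv_natCast_pow (by linarith) hB.ne'
  have hq0 : 0 < q := by
    rw [hq]
    exact Real.rpow_pos_of_pos (by linarith) _
  have hq1 : q < 1 := by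
    rw [← pow_lt_one_iff_of_nonneg hq0.le hB.ne', hqB]
    linarith
  have hlam0 : 0 < lam := by
    rw [hlam]
    have : 0 < 1 - δ := by linarith
    positivity
  have hμ0 : 0 < μ := by
    rw [hμ]
    positivity
  have hgeo : ∀ s t i j, |transition (fun k => Matrix.of (a k)) s (t + 1) i j - (m : ℝ)⁻¹| ≤
      lam * q ^ t := fun s t i j =>
    (abs_transition_sub_le hA hδ0.le hδ1.le (fun s i j =>
      pow_le_transition hA hη0.le ha_eta s _ i j (transition_pos hA
        (fun k i => hη0.trans_le (ha_diag k i)) hconn hTcomm s i j)) s (t + 1) i j).trans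
      (pow_div_le_mul_pow hB hq0 hq1 hqB hδ0 hlam t)
  have hX : ∀ i, ∀ p ∈ X i, ‖p‖ ≤ D := fun i p hp =>
    hDbound p (subset_convexHull ℝ _ (Set.mem_iUnion_of_mem i hp))
  have hxX : ∀ i k, x i k ∈ X i := fun i k => by
    cases k with
    | zero => exact hx0 i
    | succ k => exact hupd_mem i k
  have hxD : ∀ i k, ‖x i k‖ ≤ D := fun i k => hX i _ (hxX i k)
  have hsumD : ∀ k, ∑ i, ‖x i k‖ ≤ m * D := fun k => by
    simpa using sum_le_sum fun i (_ : i ∈ univ) => hxD i k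
  have hvD : ∀ k, ‖v k‖ ≤ D := fun k => by
    rw [hv, norm_smul, Real.norm_of_nonneg (by positivity), inv_mul_le_iff₀ hmR]
    exact (norm_sum_le _ _).trans (hsumD k)
  have hzD : ∀ i k, ‖z i k‖ ≤ D := fun i k => by
    rw [hz]
    calc ‖∑ j, a k i j • x j k‖ ≤ ∑ j, a k i j * D := norm_sum_le_of_le _ fun j _ => by
          rw [norm_smul, Real.norm_of_nonneg (ha_nonneg k i j)]
          exact mul_le_mul_of_nonneg_left (hxD j k) (ha_nonneg k i j)
      _ = D := by rw [← sum_mul, ha_row, one_mul]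
  have hxbarD : ‖xbar‖ ≤ D :=
    hX ⟨0, hm0⟩ _ (Set.mem_iInter.1 (hball (mem_ball_self hρ)) _)
  set e : ℕ → ℝ := fun k => ∑ i, ‖x i (k + 1) - z i k‖ with he
  set S : ℕ → ℝ := fun k => ∑ i, ‖x i (k + 1) - z i k‖ ^ 2 with hS
  have he0 : ∀ k, 0 ≤ e k := fun k => sum_nonneg fun i _ => norm_nonneg _
  have hS0 : ∀ k, 0 ≤ S k := fun k => sum_nonneg fun i _ => by positivity
  have hSzero : S 0 ≤ 4 * m * D ^ 2 := by
    have h : ∀ i, ‖x i (0 + 1) - z i 0‖ ^ 2 ≤ (2 * D) ^ 2 := fun i => by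
      have : ‖x i (0 + 1) - z i 0‖ ≤ 2 * D :=
        (norm_sub_le_of_le (hxD i _) (hzD i _)).trans_eq (two_mul D).symm
      gcongr
    have := sum_le_sum fun i (_ : i ∈ univ) => h i
    simp only [sum_const, card_univ, Fintype.card_fin, nsmul_eq_mul] at this
    linarith
  have hdev : ∀ k, ∑ i, ‖x i (k + 1) - vbar (k + 1)‖ ≤ μ * (m * lam * (q ^ k * (m * D) +
      ∑ r ∈ range k, q ^ (k - 1 - r) * e r) + 2 * e k) := fun k => by
    rw [hvbar]
    refine (sum_norm_sub_shrink_le (fun i => hxX i (k + 1)) (hvD _) hxbarD hρ (heps _)).trans ?_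
    rw [← hμ]
    refine mul_le_mul_of_nonneg_left
      ((sum_norm_sub_average_le hA hgeo hz hv hm0 k).trans ?_) hμ0.le
    gcongr
    exact hsumD 0
  have hyoung : ∀ K k, K * (c k * e k) ≤ α₁ / 2 * S k + m * (K ^ 2 / (2 * α₁)) * c k ^ 2 :=
    fun K k => by
      have := mul_sum_le_sum_sq hα0 (K * c k) fun i => ‖x i (k + 1) - z i k‖
      calc K * (c k * e k) = K * c k * e k := by ring
        _ ≤ _ := this
        _ = _ := by ring
  have hyoung_sum : ∀ K (s : Finset ℕ), K * ∑ k ∈ s, c k * e k ≤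
      α₁ / 2 * ∑ k ∈ s, S k + m * (K ^ 2 / (2 * α₁)) * ∑ k ∈ s, c k ^ 2 := fun K s => by
    rw [mul_sum, mul_sum, mul_sum, ← sum_add_distrib]
    exact sum_le_sum fun k _ => hyoung K k
  have hrange : ∀ g : ℕ → ℝ, ∑ k ∈ range N, g k + g N = g 0 + ∑ k ∈ Icc 1 N, g k := fun g => by
    rw [← sum_range_succ, sum_range_succ', add_comm, range_eq_Ico, sum_Ico_add' g 0 N 1]
    rfl
  have hsplit : 2 * Lbar * ∑ k ∈ Icc 1 N, c k * ∑ i, ‖x i (k + 1) - vbar (k + 1)‖ ≤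
      2 * Lbar * μ * m ^ 2 * lam * D * ∑ k ∈ Icc 1 N, c k * q ^ k +
      2 * Lbar * μ * m * lam * ∑ k ∈ Icc 1 N, c k * ∑ r ∈ range k, q ^ (k - 1 - r) * e r +
      4 * Lbar * μ * ∑ k ∈ Icc 1 N, c k * e k := by
    simp only [mul_sum (Icc 1 N)]
    rw [← sum_add_distrib, ← sum_add_distrib]
    refine sum_le_sum fun k _ => ?_
    calc 2 * Lbar * (c k * ∑ i, ‖x i (k + 1) - vbar (k + 1)‖)
        ≤ 2 * Lbar * (c k * (μ * (m * lam * (q ^ k * (m * D) +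
          ∑ r ∈ range k, q ^ (k - 1 - r) * e r) + 2 * e k))) := by
          have := (hc_pos k).le
          gcongr
          exact hdev k
      _ = _ := by ring
  have hgeom : 2 * Lbar * μ * m ^ 2 * lam * D * ∑ k ∈ Icc 1 N, c k * q ^ k ≤
      2 * Lbar * μ * m ^ 2 * lam * D * (c 1 * (q / (1 - q))) := by
    gcongr
    exact sum_mul_pow_le (fun k => (hc_pos k).le) hc_anti hq0.le hq1 N
  set K := 2 * Lbar * μ * m * lam * (1 - q)⁻¹ with hK
  have hq1' : 0 < 1 - q := by linarith
  have hK0 : 0 < K := by positivity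
  have hconv : 2 * Lbar * μ * m * lam *
      ∑ k ∈ Icc 1 N, c k * ∑ r ∈ range k, q ^ (k - 1 - r) * e r ≤
      K * ∑ r ∈ range N, c r * e r := by
    rw [hK, mul_assoc (2 * Lbar * μ * m * lam)]
    gcongr
    exact sum_mul_geometric_convolution_le (fun k => (hc_pos k).le) hc_anti he0 hq0.le hq1 N
  have hY₁ := hyoung_sum K (range N)
  have hY₂ := hyoung_sum (4 * Lbar * μ) (Icc 1 N)
  have hSr : α₁ / 2 * ∑ k ∈ range N, S k ≤
      α₁ / 2 * ∑ k ∈ Icc 1 N, S k + 2 * α₁ * m * D ^ 2 := by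
    have : ∑ k ∈ range N, S k ≤ ∑ k ∈ Icc 1 N, S k + 4 * m * D ^ 2 := by
      linarith [hrange S, hS0 N]
    have := mul_le_mul_of_nonneg_left this (half_pos hα0).le
    linarith
  have hcr : m * (K ^ 2 / (2 * α₁)) * ∑ k ∈ range N, c k ^ 2 <
      m * (K ^ 2 / (2 * α₁)) * (c 0 ^ 2 + ∑ k ∈ Icc 1 N, c k ^ 2) := by
    have hcN := pow_pos (hc_pos N) 2
    have := hrange fun k => c k ^ 2
    refine mul_lt_mul_of_pos_left ?_ (by positivity)
    linarith
  have hα₂' : α₂ = m * (K ^ 2 / (2 * α₁)) + m * ((4 * Lbar * μ) ^ 2 / (2 * α₁)) := by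
    rw [hα₂, hK]
    field_simp
    ring
  have hα₃' : α₃ = m * (K ^ 2 / (2 * α₁)) * c 0 ^ 2 +
      2 * Lbar * μ * m ^ 2 * lam * D * (c 1 * (q / (1 - q))) + 2 * α₁ * m * D ^ 2 := by
    rw [hα₃, hK]
    field_simp
  rw [hα₂', hα₃']
  linarith
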